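/- Let γ = (γ_u)_{u ⊂ ℕ finite} be a family of positive reals indexed by the finite subsets of ℕ with γ_∅ = 1, and for j ≥ 1 set γ̃_j := max_{v ⊆ {1,…,j−1}} γ_{v ∪ {j}}/γ_v. Assume ∑_{j ≥ 1} γ̃_j < ∞. Then for every a > 0 and every δ > 0 there exists a constant C_δ > 0 such that for all integers N ≥ 1 the family (γ_u (a ln N)^{|u|})_{u finite, u ≠ ∅} is summable with ∑_{1 ≤ |u| < ∞} γ_u (a ln N)^{|u|} < C_δ N^δ. -/

import Mathlib

open Finset

/-- A family of set weights is dominated by the product of its largest one-step ratios. -/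
theorem weight_le_prod_sup_ratio (γ : Finset ℕ → ℝ) (hγ : ∀ u, 0 < γ u) (hγ0 : γ ∅ = 1)
    (u : Finset ℕ) :
    γ u ≤ ∏ j ∈ u, ((Finset.range j).powerset).sup' (Finset.powerset_nonempty _)
        fun v => γ (insert j v) / γ v := by
  induction u using Finset.induction_on_max with
  | empty => simp [hγ0]
  | insert j v hv ih =>
    rw [Finset.prod_insert fun h => (hv j h).false]
    have hmem : v ∈ (Finset.range j).powerset :=
      Finset.mem_powerset.2 fun i hi => Finset.mem_range.2 (hv i hi)
    have hratio := Finset.le_sup' (fun v => γ (insert j v) / γ v) hmem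
    calc γ (insert j v) = γ (insert j v) / γ v * γ v := (div_mul_cancel₀ _ (hγ v).ne').symm
      _ ≤ _ := mul_le_mul hratio ih (hγ v).le ((div_pos (hγ _) (hγ v)).le.trans hratio)

theorem one_add_mul_le_max_mul_exp {x t θ : ℝ} (hx : 0 ≤ x) (hθ : 0 < θ) :
    1 + x * t ≤ max 1 (t / θ) * Real.exp (θ * x) := by
  have h : t ≤ max 1 (t / θ) * θ := (div_le_iff₀ hθ).1 (le_max_right 1 (t / θ))
  calc 1 + x * t ≤ max 1 (t / θ) + x * (max 1 (t / θ) * θ) := by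
        gcongr
        exact le_max_left _ _
    _ = max 1 (t / θ) * (θ * x + 1) := by ring
    _ ≤ _ := by
        gcongr
        exact Real.add_one_le_exp _

/-- The products `∏ (1 + x * g j)` of a summable nonnegative family grow subexponentially in `x`. -/
theorem exists_prod_one_add_mul_le_exp {ι : Type*} {g : ι → ℝ} (hg : ∀ j, 0 ≤ g j)
    (hsum : Summable g) {ε : ℝ} (hε : 0 < ε) :
    ∃ K : ℝ, 0 < K ∧ ∀ x : ℝ, 0 ≤ x → ∀ s : Finset ι,
      ∏ j ∈ s, (1 + x * g j) ≤ K * Real.exp (ε * x) := by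
  classical
  obtain ⟨T, hT⟩ := summable_iff_vanishing_norm.1 hsum (ε / 2) (half_pos hε)
  have hcard : (0 : ℝ) < #T + 1 := by positivity
  set θ : ℝ := ε / 2 / (#T + 1)
  have hθ : 0 < θ := by positivity
  refine ⟨∏ j ∈ T, max 1 (g j / θ), prod_pos fun _ _ => by positivity, fun x hx s => ?_⟩
  have hnn : ∀ j, 0 ≤ x * g j := fun j => mul_nonneg hx (hg j)
  have htail : ∏ j ∈ s \ T, (1 + x * g j) ≤ Real.exp (ε / 2 * x) := by
    calc ∏ j ∈ s \ T, (1 + x * g j) ≤ ∏ j ∈ s \ T, Real.exp (x * g j) :=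
          prod_le_prod (fun j _ => by linarith [hnn j]) fun j _ => by
            linarith [Real.add_one_le_exp (x * g j)]
      _ = Real.exp ((∑ j ∈ s \ T, g j) * x) := by rw [← Real.exp_sum, ← mul_sum, mul_comm]
      _ ≤ _ := by
          gcongr
          exact (le_abs_self _).trans (hT _ sdiff_disjoint).le
  have hhead : ∏ j ∈ T, (1 + x * g j) ≤ (∏ j ∈ T, max 1 (g j / θ)) * Real.exp (ε / 2 * x) := by
    calc ∏ j ∈ T, (1 + x * g j) ≤ ∏ j ∈ T, max 1 (g j / θ) * Real.exp (θ * x) :=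
          prod_le_prod (fun j _ => by linarith [hnn j]) fun j _ =>
            one_add_mul_le_max_mul_exp hx hθ
      _ = (∏ j ∈ T, max 1 (g j / θ)) * Real.exp (#T * θ * x) := by
          rw [prod_mul_distrib, prod_const, ← Real.exp_nat_mul, mul_assoc]
      _ ≤ _ := by
          have hle : #T * θ ≤ ε / 2 := by
            calc #T * θ ≤ (#T + 1) * θ := by gcongr; linarith
              _ = ε / 2 := mul_div_cancel₀ _ hcard.ne'
          have : 0 ≤ ∏ j ∈ T, max 1 (g j / θ) := prod_nonneg fun _ _ => by positivity
          gcongr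
  calc ∏ j ∈ s, (1 + x * g j) ≤ ∏ j ∈ T ∪ s \ T, (1 + x * g j) :=
        prod_mono_set_of_one_le (fun j => by linarith [hnn j]) (by simp)
    _ = (∏ j ∈ T, (1 + x * g j)) * ∏ j ∈ s \ T, (1 + x * g j) := prod_union disjoint_sdiff
    _ ≤ ((∏ j ∈ T, max 1 (g j / θ)) * Real.exp (ε / 2 * x)) * Real.exp (ε / 2 * x) :=
        mul_le_mul hhead htail (prod_nonneg fun j _ => by linarith [hnn j])
          ((prod_nonneg fun j _ => by linarith [hnn j]).trans hhead)
    _ = _ := by rw [mul_assoc, ← Real.exp_add, ← add_mul, add_halves]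

theorem statement_8 (γ : Finset ℕ → ℝ) (hγ : ∀ u, 0 < γ u) (hγ0 : γ ∅ = 1)
    (hsum : Summable fun j : ℕ =>
      ((Finset.range j).powerset).sup' (Finset.powerset_nonempty _)
        fun v => γ (insert j v) / γ v)
    (a : ℝ) (ha : 0 < a) (δ : ℝ) (hδ : 0 < δ) :
    ∃ C : ℝ, 0 < C ∧ ∀ N : ℕ, 1 ≤ N →
      Summable (fun u : {u : Finset ℕ // u.Nonempty} =>
        γ u.1 * (a * Real.log N) ^ u.1.card) ∧
      (∑' u : {u : Finset ℕ // u.Nonempty}, γ u.1 * (a * Real.log N) ^ u.1.card)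
        < C * (N : ℝ) ^ δ := by
  have hle := weight_le_prod_sup_ratio γ hγ hγ0
  set g : ℕ → ℝ := fun j => ((Finset.range j).powerset).sup' (Finset.powerset_nonempty _)
    fun v => γ (insert j v) / γ v
  have hg : ∀ j, 0 ≤ g j := fun j =>
    (div_pos (hγ (insert j ∅)) (hγ ∅)).le.trans
      (Finset.le_sup' (fun v => γ (insert j v) / γ v) (empty_mem_powerset _))
  obtain ⟨K, hK, hprod⟩ := exists_prod_one_add_mul_le_exp hg hsum (div_pos hδ ha)
  refine ⟨K + 1, by positivity, fun N hN => ?_⟩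
  have hNpos : (0 : ℝ) < N := by exact_mod_cast hN
  have hx : 0 ≤ a * Real.log N := mul_nonneg ha.le (Real.log_natCast_nonneg N)
  have hnn : ∀ u : {u : Finset ℕ // u.Nonempty}, 0 ≤ γ u.1 * (a * Real.log N) ^ u.1.card :=
    fun u => mul_nonneg (hγ _).le (pow_nonneg hx _)
  have hbound : ∀ S : Finset {u : Finset ℕ // u.Nonempty},
      ∑ u ∈ S, γ u.1 * (a * Real.log N) ^ u.1.card ≤ K * (N : ℝ) ^ δ := by
    intro S
    have hexp : Real.exp (δ / a * (a * Real.log N)) = (N : ℝ) ^ δ := by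
      rw [Real.rpow_def_of_pos hNpos]
      congr 1
      field_simp
    calc ∑ u ∈ S, γ u.1 * (a * Real.log N) ^ u.1.card
        ≤ ∑ u ∈ S, ∏ j ∈ u.1, a * Real.log N * g j := by
          gcongr with u
          rw [prod_mul_distrib, prod_const, mul_comm]
          exact mul_le_mul_of_nonneg_left (hle _) (pow_nonneg hx _)
      _ = ∑ u ∈ S.map (Function.Embedding.subtype _), ∏ j ∈ u, a * Real.log N * g j := by
          simp
      _ ≤ ∑ u ∈ (S.sup Subtype.val).powerset, ∏ j ∈ u, a * Real.log N * g j := by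
          refine sum_le_sum_of_subset_of_nonneg (fun u hu => ?_) fun u _ _ =>
            prod_nonneg fun j _ => mul_nonneg hx (hg j)
          obtain ⟨v, hv, rfl⟩ := Finset.mem_map.1 hu
          exact Finset.mem_powerset.2 (Finset.le_sup (f := Subtype.val) hv)
      _ = ∏ j ∈ S.sup Subtype.val, (1 + a * Real.log N * g j) := (prod_one_add _).symm
      _ ≤ K * (N : ℝ) ^ δ := hexp ▸ hprod _ hx _
  refine ⟨summable_of_sum_le hnn hbound, (Real.tsum_le_of_sum_le hnn hbound).trans_lt ?_⟩
  have : 0 < (N : ℝ) ^ δ := Real.rpow_pos_of_pos hNpos δ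
  linarith
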